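/- For any ring R, sup{Gfd_R(M) : M a Gorenstein projective R-module} is either 0 or ∞; that is, if this supremum is finite, then every Gorenstein projective R-module is Gorenstein flat. -/

import Mathlib

universe u

open CategoryTheory

/-- `extVanish R n M N` asserts that `Ext_R^n(M, N) = 0`. -/
def extVanish (R : Type u) [Ring R] (n : ℕ) (M N : ModuleCat.{u} R) : Prop :=
  letI := HasDerivedCategory.standard (ModuleCat.{u} R)
  letI : HasExt.{u + 1} (ModuleCat.{u} R) := hasExt_of_hasDerivedCategory _
  Subsingleton (Abelian.Ext M N n)

/-- A module `G` is Gorenstein projective if there is an exact sequence of projective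
modules `⋯ → P i → P (i+1) → ⋯` with `G ≅ Im (d 0)` which stays exact after applying
`Hom_R(−, Q)` for every projective module `Q`. -/
def IsGorensteinProjective (R : Type u) [Ring R] (G : ModuleCat.{u} R) : Prop :=
  ∃ (P : ℤ → ModuleCat.{u} R) (d : ∀ i : ℤ, P i →ₗ[R] P (i + 1)),
    (∀ i, Module.Projective R (P i)) ∧
    (∀ i, LinearMap.range (d i) = LinearMap.ker (d (i + 1))) ∧
    Nonempty (G ≃ₗ[R] LinearMap.range (d 0)) ∧
    ∀ (Q : ModuleCat.{u} R), Module.Projective R Q →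
      ∀ (i : ℤ) (f : P (i + 1) →ₗ[R] Q), f ∘ₗ d i = 0 →
        ∃ g : P (i + 1 + 1) →ₗ[R] Q, g ∘ₗ d (i + 1) = f

/-- A module `G` is Gorenstein injective if there is an exact sequence of injective
modules `⋯ → I i → I (i+1) → ⋯` with `G ≅ Im (d 0)` which stays exact after applying
`Hom_R(E, −)` for every injective module `E`. -/
def IsGorensteinInjective (R : Type u) [Ring R] (G : ModuleCat.{u} R) : Prop :=
  ∃ (I : ℤ → ModuleCat.{u} R) (d : ∀ i : ℤ, I i →ₗ[R] I (i + 1)),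
    (∀ i, Module.Injective R (I i)) ∧
    (∀ i, LinearMap.range (d i) = LinearMap.ker (d (i + 1))) ∧
    Nonempty (G ≃ₗ[R] LinearMap.range (d 0)) ∧
    ∀ (E : ModuleCat.{u} R), Module.Injective R E →
      ∀ (i : ℤ) (f : E →ₗ[R] I (i + 1)), d (i + 1) ∘ₗ f = 0 →
        ∃ g : E →ₗ[R] I i, d i ∘ₗ g = f
open MulOpposite in
/-- The subgroup of `I ⊗[ℤ] M` generated by the elements `(x · r) ⊗ y - x ⊗ (r · y)`,
where `I` is a right `R`-module and `M` is a left `R`-module. -/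
noncomputable def tensorRel (R : Type u) [Ring R] (I M : Type u) [AddCommGroup I] [Module Rᵐᵒᵖ I]
    [AddCommGroup M] [Module R M] : AddSubgroup (TensorProduct ℤ I M) :=
  AddSubgroup.closure
    {z | ∃ (r : R) (x : I) (y : M), z = (op r • x) ⊗ₜ[ℤ] y - x ⊗ₜ[ℤ] (r • y)}

/-- The tensor product `I ⊗_R M` of a right `R`-module `I` with a left `R`-module `M`
over an arbitrary ring `R`, realized as a quotient of `I ⊗[ℤ] M`. -/
noncomputable def RTensor (R : Type u) [Ring R] (I M : Type u) [AddCommGroup I] [Module Rᵐᵒᵖ I]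
    [AddCommGroup M] [Module R M] : Type u :=
  TensorProduct ℤ I M ⧸ tensorRel R I M

noncomputable instance (R : Type u) [Ring R] (I M : Type u) [AddCommGroup I]
    [Module Rᵐᵒᵖ I] [AddCommGroup M] [Module R M] : AddCommGroup (RTensor R I M) :=
  QuotientAddGroup.Quotient.addCommGroup _

open MulOpposite in
/-- The map `I ⊗_R M →+ I ⊗_R M'` induced on tensor products by an `R`-linear map
`f : M →ₗ[R] M'`. -/
noncomputable def RTensor.mapRight (R : Type u) [Ring R] (I : Type u) [AddCommGroup I]
    [Module Rᵐᵒᵖ I] {M M' : Type u} [AddCommGroup M] [Module R M] [AddCommGroup M']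
    [Module R M'] (f : M →ₗ[R] M') : RTensor R I M →+ RTensor R I M' :=
  QuotientAddGroup.map _ _
    (TensorProduct.map (LinearMap.id) f.toAddMonoidHom.toIntLinearMap).toAddMonoidHom
    (by
      refine (AddSubgroup.closure_le _).2 ?_
      rintro z ⟨r, x, y, rfl⟩
      refine AddSubgroup.subset_closure ⟨r, x, f y, ?_⟩
      simp [TensorProduct.map_tmul, map_sub, map_smul])

open MulOpposite in
/-- The map `I ⊗_R M →+ I' ⊗_R M` induced on tensor products by a map of right modules
`f : I →ₗ[Rᵐᵒᵖ] I'`. -/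
noncomputable def RTensor.mapLeft (R : Type u) [Ring R] {I I' : Type u} [AddCommGroup I]
    [Module Rᵐᵒᵖ I] [AddCommGroup I'] [Module Rᵐᵒᵖ I'] (f : I →ₗ[Rᵐᵒᵖ] I')
    (M : Type u) [AddCommGroup M] [Module R M] : RTensor R I M →+ RTensor R I' M :=
  QuotientAddGroup.map _ _
    (TensorProduct.map f.toAddMonoidHom.toIntLinearMap (LinearMap.id)).toAddMonoidHom
    (by
      refine (AddSubgroup.closure_le _).2 ?_
      rintro z ⟨r, x, y, rfl⟩
      refine AddSubgroup.subset_closure ⟨r, f x, y, ?_⟩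
      simp [TensorProduct.map_tmul, map_sub, map_smul])

/-- A left `R`-module `M` over an arbitrary ring `R` is flat if tensoring with `M`
preserves injectivity of maps of right `R`-modules. -/
def IsFlatModule (R : Type u) [Ring R] (M : Type u) [AddCommGroup M] [Module R M] : Prop :=
  ∀ (A B : Type u) [AddCommGroup A] [Module Rᵐᵒᵖ A] [AddCommGroup B] [Module Rᵐᵒᵖ B]
    (f : A →ₗ[Rᵐᵒᵖ] B), Function.Injective f → Function.Injective (RTensor.mapLeft R f M)

/-- A module `M` is Gorenstein flat if there is an exact sequence of flat modules
`⋯ → F i → F (i+1) → ⋯` with `M ≅ Im (d 0)` which stays exact after applying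
`I ⊗_R −` for every injective right `R`-module `I`. -/
def IsGorensteinFlat (R : Type u) [Ring R] (M : ModuleCat.{u} R) : Prop :=
  ∃ (F : ℤ → ModuleCat.{u} R) (d : ∀ i : ℤ, F i →ₗ[R] F (i + 1)),
    (∀ i, IsFlatModule R (F i)) ∧
    (∀ i, LinearMap.range (d i) = LinearMap.ker (d (i + 1))) ∧
    Nonempty (M ≃ₗ[R] LinearMap.range (d 0)) ∧
    ∀ (I : Type u) [AddCommGroup I] [Module Rᵐᵒᵖ I], Module.Injective Rᵐᵒᵖ I →
      ∀ i : ℤ, (RTensor.mapRight R I (d i)).range = (RTensor.mapRight R I (d (i + 1))).ker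

/-- `gfdLE R n M` means that `M` admits a resolution `0 → Gₙ → ⋯ → G₀ → M → 0` by
Gorenstein flat modules, i.e. the Gorenstein flat dimension of `M` is at most `n`. -/
def gfdLE (R : Type u) [Ring R] : ℕ → ModuleCat.{u} R → Prop
  | 0, M => IsGorensteinFlat R M
  | n + 1, M => ∃ (K G : ModuleCat.{u} R) (f : K →ₗ[R] G) (g : G →ₗ[R] M),
      IsGorensteinFlat R G ∧ Function.Injective f ∧ Function.Surjective g ∧
      LinearMap.range f = LinearMap.ker g ∧ gfdLE R n K

/-- The Gorenstein flat dimension of `M` as an element of `ℕ∞` (`⊤` if `M` has no finite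
Gorenstein flat resolution). -/
noncomputable def gfd (R : Type u) [Ring R] (M : ModuleCat.{u} R) : ℕ∞ :=
  sInf {n : ℕ∞ | ∃ m : ℕ, n = (m : ℕ∞) ∧ gfdLE R m M}

open MulOpposite

/-! ### Characters of abelian groups -/

/-- A character of a subgroup of an abelian group extends to the whole group. -/
lemma exists_character_extension {A B : Type u} [AddCommGroup A] [AddCommGroup B] (f : A →+ B)
    (hf : Function.Injective f) (χ : A →+ AddCircle (1 : ℚ)) :
    ∃ ψ : B →+ AddCircle (1 : ℚ), ψ.comp f = χ :=
  CharacterModule.dual_surjective_of_injective f.toIntLinearMap hf χ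

lemma injective_of_character_extension {A B : Type u} [AddCommGroup A] [AddCommGroup B]
    (f : A →+ B) (h : ∀ χ : A →+ AddCircle (1 : ℚ), ∃ ψ : B →+ AddCircle (1 : ℚ), ψ.comp f = χ) :
    Function.Injective f :=
  (CharacterModule.dual_surjective_iff_injective (f := f.toIntLinearMap)).1 h

lemma range_eq_ker_iff_character {A B C : Type u} [AddCommGroup A] [AddCommGroup B]
    [AddCommGroup C] (α : A →+ B) (β : B →+ C) (hαβ : β.comp α = 0) :
    α.range = β.ker ↔ ∀ χ : B →+ AddCircle (1 : ℚ), χ.comp α = 0 →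
      ∃ ψ : C →+ AddCircle (1 : ℚ), ψ.comp β = χ := by
  constructor
  · intro h χ hχ
    have hker : β.ker ≤ χ.ker := by
      rw [← h]
      rintro _ ⟨a, rfl⟩
      exact DFunLike.congr_fun hχ a
    obtain ⟨ψ, hψ⟩ := exists_character_extension (QuotientAddGroup.kerLift β)
      (QuotientAddGroup.kerLift_injective β) (QuotientAddGroup.lift β.ker χ hker)
    refine ⟨ψ, ?_⟩
    ext b
    exact DFunLike.congr_fun hψ (b : B ⧸ β.ker)
  · intro h
    refine le_antisymm ?_ fun b hb ↦ ?_
    · rintro _ ⟨a, rfl⟩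
      exact DFunLike.congr_fun hαβ a
    · rw [← QuotientAddGroup.eq_zero_iff]
      refine CharacterModule.eq_zero_of_character_apply fun c ↦ ?_
      let χ : B →+ AddCircle (1 : ℚ) := AddMonoidHom.comp c (QuotientAddGroup.mk' α.range)
      obtain ⟨ψ, hψ⟩ := h χ (by
        ext a
        have : ((α a : B) : B ⧸ α.range) = 0 := (QuotientAddGroup.eq_zero_iff _).2 ⟨a, rfl⟩
        change c ((α a : B) : B ⧸ α.range) = 0
        rw [this, map_zero])
      change χ b = 0
      rw [← hψ, AddMonoidHom.comp_apply, (AddMonoidHom.mem_ker).1 hb, map_zero]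

/-- The left `R`-module of characters of a right `R`-module. -/
def LeftCharacter (A : Type u) [AddCommGroup A] : Type u := A →+ AddCircle (1 : ℚ)

/-- The right `R`-module of characters of a left `R`-module. -/
def RightCharacter (M : Type u) [AddCommGroup M] : Type u := M →+ AddCircle (1 : ℚ)

noncomputable instance (A : Type u) [AddCommGroup A] : AddCommGroup (LeftCharacter A) :=
  inferInstanceAs (AddCommGroup (A →+ AddCircle (1 : ℚ)))

noncomputable instance (M : Type u) [AddCommGroup M] : AddCommGroup (RightCharacter M) :=
  inferInstanceAs (AddCommGroup (M →+ AddCircle (1 : ℚ)))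

instance (A : Type u) [AddCommGroup A] : FunLike (LeftCharacter A) A (AddCircle (1 : ℚ)) :=
  inferInstanceAs (FunLike (A →+ AddCircle (1 : ℚ)) A (AddCircle (1 : ℚ)))

instance (M : Type u) [AddCommGroup M] : FunLike (RightCharacter M) M (AddCircle (1 : ℚ)) :=
  inferInstanceAs (FunLike (M →+ AddCircle (1 : ℚ)) M (AddCircle (1 : ℚ)))

instance (A : Type u) [AddCommGroup A] :
    AddMonoidHomClass (LeftCharacter A) A (AddCircle (1 : ℚ)) :=
  inferInstanceAs (AddMonoidHomClass (A →+ AddCircle (1 : ℚ)) A (AddCircle (1 : ℚ)))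

instance (M : Type u) [AddCommGroup M] :
    AddMonoidHomClass (RightCharacter M) M (AddCircle (1 : ℚ)) :=
  inferInstanceAs (AddMonoidHomClass (M →+ AddCircle (1 : ℚ)) M (AddCircle (1 : ℚ)))

@[simp] lemma LeftCharacter.add_apply {A : Type u} [AddCommGroup A] (φ ψ : LeftCharacter A)
    (a : A) : (φ + ψ) a = φ a + ψ a := rfl

@[simp] lemma RightCharacter.add_apply {M : Type u} [AddCommGroup M] (φ ψ : RightCharacter M)
    (m : M) : (φ + ψ) m = φ m + ψ m := rfl

section Ring

variable {R : Type u} [Ring R]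

noncomputable instance (A : Type u) [AddCommGroup A] [Module Rᵐᵒᵖ A] :
    Module R (LeftCharacter A) where
  smul r φ := (φ : A →+ AddCircle (1 : ℚ)).comp (DistribSMul.toAddMonoidHom A (op r))
  one_smul φ := DFunLike.ext _ _ fun a ↦ congrArg φ (one_smul Rᵐᵒᵖ a)
  mul_smul r s φ := DFunLike.ext _ _ fun a ↦ congrArg φ (mul_smul (op s) (op r) a)
  smul_zero _ := rfl
  smul_add _ _ _ := rfl
  add_smul r s φ := DFunLike.ext _ _ fun a ↦
    (congrArg φ (add_smul (op r) (op s) a)).trans (map_add φ _ _)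
  zero_smul φ := DFunLike.ext _ _ fun a ↦
    (congrArg φ (zero_smul Rᵐᵒᵖ a)).trans (map_zero φ)

noncomputable instance (M : Type u) [AddCommGroup M] [Module R M] :
    Module Rᵐᵒᵖ (RightCharacter M) where
  smul r φ := (φ : M →+ AddCircle (1 : ℚ)).comp (DistribSMul.toAddMonoidHom M (unop r))
  one_smul φ := DFunLike.ext _ _ fun a ↦ congrArg φ (one_smul R a)
  mul_smul r s φ := DFunLike.ext _ _ fun a ↦ congrArg φ (mul_smul (unop s) (unop r) a)
  smul_zero _ := rfl
  smul_add _ _ _ := rfl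
  add_smul r s φ := DFunLike.ext _ _ fun a ↦
    (congrArg φ (add_smul (unop r) (unop s) a)).trans (map_add φ _ _)
  zero_smul φ := DFunLike.ext _ _ fun a ↦
    (congrArg φ (zero_smul R a)).trans (map_zero φ)

/-- The map on characters induced by a map of right modules. -/
noncomputable def LeftCharacter.map {A B : Type u} [AddCommGroup A] [Module Rᵐᵒᵖ A]
    [AddCommGroup B] [Module Rᵐᵒᵖ B] (f : A →ₗ[Rᵐᵒᵖ] B) :
    LeftCharacter B →ₗ[R] LeftCharacter A where
  toFun φ := (φ : B →+ AddCircle (1 : ℚ)).comp f.toAddMonoidHom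
  map_add' _ _ := rfl
  map_smul' r φ := DFunLike.ext _ _ fun a ↦ congrArg φ (f.map_smul (op r) a).symm

/-- The map on characters induced by a map of left modules. -/
noncomputable def RightCharacter.map {M N : Type u} [AddCommGroup M] [Module R M]
    [AddCommGroup N] [Module R N] (f : M →ₗ[R] N) :
    RightCharacter N →ₗ[Rᵐᵒᵖ] RightCharacter M where
  toFun φ := (φ : N →+ AddCircle (1 : ℚ)).comp f.toAddMonoidHom
  map_add' _ _ := rfl
  map_smul' r φ := DFunLike.ext _ _ fun a ↦ congrArg φ (f.map_smul (unop r) a).symm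

lemma LeftCharacter.map_surjective {A B : Type u} [AddCommGroup A] [Module Rᵐᵒᵖ A]
    [AddCommGroup B] [Module Rᵐᵒᵖ B] (f : A →ₗ[Rᵐᵒᵖ] B) (hf : Function.Injective f) :
    Function.Surjective (LeftCharacter.map f) :=
  exists_character_extension f.toAddMonoidHom hf

variable {A B : Type u} [AddCommGroup A] [Module Rᵐᵒᵖ A] [AddCommGroup B] [Module Rᵐᵒᵖ B]
  {M N : Type u} [AddCommGroup M] [Module R M] [AddCommGroup N] [Module R N]

/-- A map of right modules into a character module, with its two variables exchanged. -/
noncomputable def RightCharacter.flip (g : A →ₗ[Rᵐᵒᵖ] RightCharacter M) :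
    M →ₗ[R] LeftCharacter A where
  toFun m := AddMonoidHom.mk' (fun a ↦ g a m) fun a b ↦ by simp
  map_add' m n := DFunLike.ext _ _ fun a ↦ map_add (g a) m n
  map_smul' r m := DFunLike.ext _ _ fun a ↦
    (DFunLike.congr_fun (g.map_smul (op r) a) m).symm

/-- A map of left modules into a character module, with its two variables exchanged. -/
noncomputable def LeftCharacter.flip (g : M →ₗ[R] LeftCharacter A) :
    A →ₗ[Rᵐᵒᵖ] RightCharacter M where
  toFun a := AddMonoidHom.mk' (fun m ↦ g m a) fun m n ↦ by simp
  map_add' a b := DFunLike.ext _ _ fun m ↦ map_add (g m) a b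
  map_smul' r a := DFunLike.ext _ _ fun m ↦
    (DFunLike.congr_fun (g.map_smul (unop r) m) a).symm

/-! ### Tensor-hom adjunction -/

/-- The pure tensor `a ⊗ m`. -/
noncomputable def RTensor.tmul (R : Type u) [Ring R] {A M : Type u} [AddCommGroup A]
    [Module Rᵐᵒᵖ A] [AddCommGroup M] [Module R M] (a : A) (m : M) : RTensor R A M :=
  QuotientAddGroup.mk' (tensorRel R A M) (a ⊗ₜ[ℤ] m)

lemma RTensor.mapRight_tmul (f : M →ₗ[R] N) (a : A) (m : M) :
    RTensor.mapRight R A f (RTensor.tmul R a m) = RTensor.tmul R a (f m) := rfl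

lemma RTensor.hom_ext {C : Type*} [AddCommGroup C] {φ ψ : RTensor R A M →+ C}
    (h : ∀ a m, φ (RTensor.tmul R a m) = ψ (RTensor.tmul R a m)) : φ = ψ := by
  refine QuotientAddGroup.addMonoidHom_ext _ ?_
  ext x
  induction x using TensorProduct.induction_on with
  | zero => simp
  | tmul a m => exact h a m
  | add x y hx hy => rw [map_add, map_add, hx, hy]

lemma RTensor.op_smul_tmul (r : R) (a : A) (m : M) :
    RTensor.tmul R (op r • a) m = RTensor.tmul R a (r • m) := by
  have h := (QuotientAddGroup.eq_zero_iff (N := tensorRel R A M)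
    ((op r • a) ⊗ₜ[ℤ] m - a ⊗ₜ[ℤ] (r • m))).2 (AddSubgroup.subset_closure ⟨r, a, m, rfl⟩)
  exact sub_eq_zero.1 h

lemma RTensor.tmul_add (a : A) (m n : M) :
    RTensor.tmul R a (m + n) = RTensor.tmul R a m + RTensor.tmul R a n := by
  rw [RTensor.tmul, TensorProduct.tmul_add, map_add]
  rfl

lemma RTensor.add_tmul (a b : A) (m : M) :
    RTensor.tmul R (a + b) m = RTensor.tmul R a m + RTensor.tmul R b m := by
  rw [RTensor.tmul, TensorProduct.add_tmul, map_add]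
  rfl

lemma RTensor.tmul_zero (a : A) : RTensor.tmul R a (0 : M) = 0 := by
  rw [RTensor.tmul, TensorProduct.tmul_zero, map_zero]
  rfl

/-- The map `M → A⁺` corresponding to a character of `A ⊗ M`. -/
noncomputable def RTensor.curry (χ : RTensor R A M →+ AddCircle (1 : ℚ)) :
    M →ₗ[R] LeftCharacter A where
  toFun m := AddMonoidHom.mk' (fun a ↦ χ (RTensor.tmul R a m)) fun a b ↦ by
    rw [RTensor.add_tmul, map_add]
  map_add' m n := DFunLike.ext _ _ fun a ↦
    (congrArg χ (RTensor.tmul_add a m n)).trans (map_add χ _ _)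
  map_smul' r m := DFunLike.ext _ _ fun a ↦ congrArg χ (RTensor.op_smul_tmul r a m).symm

/-- The character of `A ⊗ M` corresponding to a map `M → A⁺`. -/
noncomputable def RTensor.uncurry (g : M →ₗ[R] LeftCharacter A) :
    RTensor R A M →+ AddCircle (1 : ℚ) :=
  QuotientAddGroup.lift (tensorRel R A M)
    (TensorProduct.liftAddHom
      (AddMonoidHom.mk' (fun a ↦ (LeftCharacter.flip g a : M →+ AddCircle (1 : ℚ)))
        fun a b ↦ map_add (LeftCharacter.flip g) a b)
      fun n a m ↦ (map_zsmul (g m) n a).trans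
        (map_zsmul (LeftCharacter.flip g a) n m).symm)
    (by
      refine (AddSubgroup.closure_le _).2 ?_
      rintro _ ⟨r, a, m, rfl⟩
      change _ = _
      rw [map_sub, sub_eq_zero]
      exact (DFunLike.congr_fun (g.map_smul r m) a).symm)

/-- Exactness of `A ⊗ -` at a spot of a complex, in terms of maps to the character module. -/
lemma RTensor.range_mapRight_eq_ker_iff {L : Type u} [AddCommGroup L] [Module R L]
    (f : L →ₗ[R] M) (g : M →ₗ[R] N) (hgf : g ∘ₗ f = 0) :
    (RTensor.mapRight R A f).range = (RTensor.mapRight R A g).ker ↔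
      ∀ φ : M →ₗ[R] LeftCharacter A, φ ∘ₗ f = 0 →
        ∃ ψ : N →ₗ[R] LeftCharacter A, ψ ∘ₗ g = φ := by
  rw [range_eq_ker_iff_character]
  · constructor
    · intro h φ hφ
      obtain ⟨ψ, hψ⟩ := h (RTensor.uncurry φ) (RTensor.hom_ext fun a l ↦
        DFunLike.congr_fun (LinearMap.congr_fun hφ l) a)
      exact ⟨RTensor.curry ψ, LinearMap.ext fun m ↦ DFunLike.ext _ _ fun a ↦
        DFunLike.congr_fun hψ (RTensor.tmul R a m)⟩
    · intro h χ hχ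
      obtain ⟨ψ, hψ⟩ := h (RTensor.curry χ) (LinearMap.ext fun l ↦ DFunLike.ext _ _ fun a ↦
        DFunLike.congr_fun hχ (RTensor.tmul R a l))
      exact ⟨RTensor.uncurry ψ, RTensor.hom_ext fun a m ↦
        DFunLike.congr_fun (LinearMap.congr_fun hψ m) a⟩
  · refine RTensor.hom_ext fun a l ↦ ?_
    have h : g (f l) = 0 := LinearMap.congr_fun hgf l
    rw [AddMonoidHom.comp_apply, RTensor.mapRight_tmul, RTensor.mapRight_tmul, h]
    exact RTensor.tmul_zero a

/-! ### Flat modules -/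

/-- Lambek's criterion: a module is flat if and only if its character module is injective. -/
lemma isFlatModule_iff_injective_rightCharacter :
    IsFlatModule R M ↔ Module.Injective Rᵐᵒᵖ (RightCharacter M) := by
  constructor
  · refine fun h ↦ ⟨fun X Y _ _ _ _ f hf g ↦ ?_⟩
    obtain ⟨ψ, hψ⟩ := exists_character_extension _ (h X Y f hf)
      (RTensor.uncurry (RightCharacter.flip g))
    exact ⟨LeftCharacter.flip (RTensor.curry ψ), fun x ↦ DFunLike.ext _ _ fun m ↦
      DFunLike.congr_fun hψ (RTensor.tmul R x m)⟩
  · intro h X Y _ _ _ _ f hf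
    refine injective_of_character_extension _ fun χ ↦ ?_
    obtain ⟨ψ, hψ⟩ := h.out f hf (LeftCharacter.flip (RTensor.curry χ))
    exact ⟨RTensor.uncurry (RightCharacter.flip ψ), RTensor.hom_ext fun a m ↦
      DFunLike.congr_fun (hψ a) m⟩

lemma IsFlatModule.of_projective [Module.Projective R M] : IsFlatModule R M := by
  refine isFlatModule_iff_injective_rightCharacter.2 ⟨fun X Y _ _ _ _ f hf g ↦ ?_⟩
  obtain ⟨ψ, hψ⟩ := Module.projective_lifting_property (LeftCharacter.map f)
    (RightCharacter.flip g) (LeftCharacter.map_surjective f hf)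
  exact ⟨LeftCharacter.flip ψ, fun x ↦ DFunLike.ext _ _ fun m ↦
    DFunLike.congr_fun (LinearMap.congr_fun hψ m) x⟩

/-- Applying characters to a short exact sequence ending in a flat module gives a split exact
sequence. -/
lemma IsFlatModule.exists_section {L : Type u} [AddCommGroup L] [Module R L] (hN : IsFlatModule R N)
    (f : L →ₗ[R] M) (g : M →ₗ[R] N) (hf : Function.Injective f) (hg : Function.Surjective g)
    (hfg : LinearMap.range f = LinearMap.ker g) :
    ∃ s : RightCharacter L →ₗ[Rᵐᵒᵖ] RightCharacter M,
      RightCharacter.map f ∘ₗ s = LinearMap.id := by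
  have hinj : Function.Injective (RightCharacter.map g) := fun φ ψ h ↦
    DFunLike.ext _ _ fun n ↦ by
      obtain ⟨m, rfl⟩ := hg n
      exact DFunLike.congr_fun h m
  have hsurj : Function.Surjective (RightCharacter.map f) :=
    exists_character_extension f.toAddMonoidHom hf
  obtain ⟨r, hr⟩ := (isFlatModule_iff_injective_rightCharacter.1 hN).out
    (RightCharacter.map g) hinj LinearMap.id
  have hgf : ∀ l, g (f l) = 0 := fun l ↦ by
    have : f l ∈ LinearMap.ker g := hfg ▸ LinearMap.mem_range_self f l
    exact this
  have hexact : Function.Exact (RightCharacter.map g) (RightCharacter.map f) := by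
    intro φ
    constructor
    · intro hφ
      have hker : g.toAddMonoidHom.ker ≤ (φ : M →+ AddCircle (1 : ℚ)).ker := by
        intro m hm
        obtain ⟨l, rfl⟩ : m ∈ LinearMap.range f := hfg ▸ hm
        exact DFunLike.congr_fun hφ l
      refine ⟨AddMonoidHom.liftOfSurjective g.toAddMonoidHom hg
        ⟨(φ : M →+ AddCircle (1 : ℚ)), hker⟩, DFunLike.ext _ _ fun m ↦ ?_⟩
      exact AddMonoidHom.liftOfRightInverse_comp_apply g.toAddMonoidHom _
        (Function.rightInverse_surjInv hg) ⟨(φ : M →+ AddCircle (1 : ℚ)), hker⟩ m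
    · rintro ⟨φ, rfl⟩
      exact DFunLike.ext _ _ fun l ↦ (congrArg φ (hgf l)).trans (map_zero φ)
  exact (((Function.Exact.split_tfae' hexact).out 1 0 rfl rfl).1
    ⟨hsurj, r, LinearMap.ext hr⟩).2

lemma IsFlatModule.of_shortExact {L : Type u} [AddCommGroup L] [Module R L]
    (hM : IsFlatModule R M) (hN : IsFlatModule R N)
    (f : L →ₗ[R] M) (g : M →ₗ[R] N) (hf : Function.Injective f) (hg : Function.Surjective g)
    (hfg : LinearMap.range f = LinearMap.ker g) : IsFlatModule R L := by
  obtain ⟨s, hs⟩ := hN.exists_section f g hf hg hfg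
  rw [isFlatModule_iff_injective_rightCharacter] at hM ⊢
  refine ⟨fun X Y _ _ _ _ i hi φ ↦ ?_⟩
  obtain ⟨ψ, hψ⟩ := hM.out i hi (s ∘ₗ φ)
  refine ⟨RightCharacter.map f ∘ₗ ψ, fun x ↦ ?_⟩
  rw [LinearMap.comp_apply, hψ]
  exact LinearMap.congr_fun hs (φ x)

lemma IsFlatModule.exists_extension {L : Type u} [AddCommGroup L] [Module R L]
    (hN : IsFlatModule R N)
    (f : L →ₗ[R] M) (g : M →ₗ[R] N) (hf : Function.Injective f) (hg : Function.Surjective g)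
    (hfg : LinearMap.range f = LinearMap.ker g) (φ : L →ₗ[R] LeftCharacter A) :
    ∃ ψ : M →ₗ[R] LeftCharacter A, ψ ∘ₗ f = φ := by
  obtain ⟨s, hs⟩ := hN.exists_section f g hf hg hfg
  refine ⟨RightCharacter.flip (s ∘ₗ LeftCharacter.flip φ), LinearMap.ext fun l ↦
    DFunLike.ext _ _ fun a ↦ ?_⟩
  exact DFunLike.congr_fun (LinearMap.congr_fun hs (LeftCharacter.flip φ a)) l

end Ring

/-! ### Vanishing of `Ext` -/

section Ext

open Abelian

variable {R : Type u} [Ring R] {K M N : Type u} [AddCommGroup K] [Module R K] [AddCommGroup M]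
  [Module R M] [AddCommGroup N] [Module R N] (Y : ModuleCat.{u} R)

lemma subsingleton_ext_of_linearEquiv (e : M ≃ₗ[R] N) (n : ℕ)
    (h : Subsingleton (Ext (ModuleCat.of R N) Y n)) : Subsingleton (Ext (ModuleCat.of R M) Y n) := by
  refine subsingleton_of_forall_eq 0 fun x ↦ ?_
  have hx := Ext.mk₀_id_comp x
  rw [← e.toModuleIso.hom_inv_id, ← Ext.mk₀_comp_mk₀_assoc,
    Subsingleton.elim ((Ext.mk₀ e.toModuleIso.inv).comp x (zero_add n)) 0, Ext.comp_zero] at hx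
  exact hx.symm

lemma subsingleton_ext_succ_of_projective [Module.Projective R M] (n : ℕ) :
    Subsingleton (Ext (ModuleCat.of R M) Y (n + 1)) :=
  subsingleton_of_forall_eq 0 Ext.eq_zero_of_projective

/-- `0 → K → M → N → 0` is a short exact sequence of modules. -/
structure IsShortExact (f : K →ₗ[R] M) (g : M →ₗ[R] N) : Prop where
  injective : Function.Injective f
  surjective : Function.Surjective g
  range_eq_ker : LinearMap.range f = LinearMap.ker g

namespace IsShortExact

variable {Y} {f : K →ₗ[R] M} {g : M →ₗ[R] N} (h : IsShortExact f g)

include h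

lemma comp_eq_zero : g ∘ₗ f = 0 := LinearMap.range_le_ker_iff.1 h.range_eq_ker.le

lemma shortExact : (ModuleCat.shortComplexOfCompEqZero f g h.comp_eq_zero).ShortExact :=
  ModuleCat.shortComplex_shortExact _ (LinearMap.exact_iff.2 h.range_eq_ker.symm) h.injective
    h.surjective

lemma subsingleton_ext_right {n : ℕ} (hK : Subsingleton (Ext (ModuleCat.of R K) Y n))
    (hM : Subsingleton (Ext (ModuleCat.of R M) Y (n + 1))) :
    Subsingleton (Ext (ModuleCat.of R N) Y (n + 1)) := by
  refine subsingleton_of_forall_eq 0 fun x ↦ ?_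
  obtain ⟨y, rfl⟩ := Ext.contravariant_sequence_exact₃ h.shortExact Y x
    (hM.elim _ _) (add_comm 1 n)
  rw [hK.elim y 0, Ext.comp_zero]

lemma subsingleton_ext_left {n : ℕ} (hM : Subsingleton (Ext (ModuleCat.of R M) Y n))
    (hN : Subsingleton (Ext (ModuleCat.of R N) Y (n + 1))) :
    Subsingleton (Ext (ModuleCat.of R K) Y n) := by
  refine subsingleton_of_forall_eq 0 fun x ↦ ?_
  obtain ⟨y, rfl⟩ := Ext.contravariant_sequence_exact₁ h.shortExact Y x (add_comm 1 n)
    (hN.elim _ _)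
  rw [hM.elim y 0, Ext.comp_zero]

lemma exists_extension (hN : Subsingleton (Ext (ModuleCat.of R N) Y 1)) (φ : K →ₗ[R] Y) :
    ∃ ψ : M →ₗ[R] Y, ψ ∘ₗ f = φ := by
  obtain ⟨y, hy⟩ := Ext.contravariant_sequence_exact₁ h.shortExact Y
    (Ext.mk₀ (ModuleCat.ofHom φ : ModuleCat.of R K ⟶ Y)) (add_zero 1) (hN.elim _ _)
  obtain ⟨ψ, rfl⟩ := (Ext.mk₀_bijective _ _).2 y
  rw [Ext.mk₀_comp_mk₀] at hy
  have := (Ext.mk₀_bijective _ _).1 hy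
  exact ⟨ψ.hom, congrArg ModuleCat.Hom.hom this⟩

lemma subsingleton_ext_one (hM : Subsingleton (Ext (ModuleCat.of R M) Y 1))
    (hext : ∀ φ : K →ₗ[R] Y, ∃ ψ : M →ₗ[R] Y, ψ ∘ₗ f = φ) :
    Subsingleton (Ext (ModuleCat.of R N) Y 1) := by
  refine subsingleton_of_forall_eq 0 fun x ↦ ?_
  obtain ⟨y, rfl⟩ := Ext.contravariant_sequence_exact₃ h.shortExact Y x
    (hM.elim _ _) (add_zero 1)
  obtain ⟨φ, rfl⟩ := (Ext.mk₀_bijective _ _).2 y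
  obtain ⟨ψ, hψ⟩ := hext φ.hom
  have hφ : φ = (ModuleCat.shortComplexOfCompEqZero f g h.comp_eq_zero).f ≫
      (ModuleCat.ofHom ψ : ModuleCat.of R M ⟶ Y) := by
    ext k
    exact (LinearMap.congr_fun hψ k).symm
  rw [hφ, ← Ext.mk₀_comp_mk₀]
  exact h.shortExact.extClass_comp_assoc _

end IsShortExact

/-- Every module is a quotient of a projective module. -/
lemma exists_isShortExact_projective (N : Type u) [AddCommGroup N] [Module R N] :
    ∃ (K P : ModuleCat.{u} R) (f : K →ₗ[R] P) (g : P →ₗ[R] N),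
      Module.Projective R P ∧ IsShortExact f g :=
  let g : (N →₀ R) →ₗ[R] N := Finsupp.linearCombination R id
  ⟨ModuleCat.of R (LinearMap.ker g), ModuleCat.of R (N →₀ R), (LinearMap.ker g).subtype, g,
    inferInstanceAs (Module.Projective R (N →₀ R)), Subtype.val_injective,
    Finsupp.linearCombination_id_surjective R N, Submodule.range_subtype _⟩

variable (A : Type u) [AddCommGroup A] [Module Rᵐᵒᵖ A]

lemma IsFlatModule.subsingleton_ext (n : ℕ) (M : Type u) [AddCommGroup M] [Module R M]
    (hM : IsFlatModule R M) :
    Subsingleton (Ext (ModuleCat.of R M) (ModuleCat.of R (LeftCharacter A)) (n + 1)) := by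
  induction n generalizing M with
  | zero =>
    obtain ⟨K, P, f, g, hP, h⟩ := exists_isShortExact_projective (R := R) M
    exact h.subsingleton_ext_one (subsingleton_ext_succ_of_projective _ 0) fun φ ↦
      hM.exists_extension f g h.injective h.surjective h.range_eq_ker φ
  | succ n ih =>
    obtain ⟨K, P, f, g, hP, h⟩ := exists_isShortExact_projective (R := R) M
    exact h.subsingleton_ext_right (ih K (IsFlatModule.of_projective.of_shortExact hM f g
      h.injective h.surjective h.range_eq_ker)) (subsingleton_ext_succ_of_projective _ (n + 1))

/-! ### Complexes -/

section Complex

variable {F : ℤ → ModuleCat.{u} R} {d : ∀ i : ℤ, F i →ₗ[R] F (i + 1)}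
  (hd : ∀ i, LinearMap.range (d i) = LinearMap.ker (d (i + 1)))

include hd

lemma isShortExact_range (i : ℤ) :
    IsShortExact (LinearMap.range (d i)).subtype (d (i + 1)).rangeRestrict :=
  ⟨Subtype.val_injective, LinearMap.surjective_rangeRestrict _, by
    rw [Submodule.range_subtype, LinearMap.ker_rangeRestrict, hd]⟩

lemma comp_eq_zero_of_range_eq_ker (i : ℤ) : d (i + 1) ∘ₗ d i = 0 :=
  LinearMap.range_le_ker_iff.1 (hd i).le

/-- Exactness of `Hom(F, Y)` at a spot means that maps from the cycles to `Y` extend. -/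
lemma hom_exact_iff_extension (i : ℤ) :
    (∀ φ : F (i + 1) →ₗ[R] Y, φ ∘ₗ d i = 0 →
      ∃ ψ : F (i + 1 + 1) →ₗ[R] Y, ψ ∘ₗ d (i + 1) = φ) ↔
    ∀ φ : LinearMap.range (d (i + 1)) →ₗ[R] Y,
      ∃ ψ : F (i + 1 + 1) →ₗ[R] Y, ψ ∘ₗ (LinearMap.range (d (i + 1))).subtype = φ := by
  constructor
  · intro h φ
    obtain ⟨ψ, hψ⟩ := h (φ ∘ₗ (d (i + 1)).rangeRestrict) (by
      rw [LinearMap.comp_assoc]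
      have : (d (i + 1)).rangeRestrict ∘ₗ d i = 0 := by
        ext x
        exact LinearMap.congr_fun (comp_eq_zero_of_range_eq_ker hd i) x
      rw [this, LinearMap.comp_zero])
    refine ⟨ψ, ?_⟩
    ext ⟨_, x, rfl⟩
    exact LinearMap.congr_fun hψ x
  · intro h φ hφ
    have hker : LinearMap.ker (d (i + 1)).rangeRestrict ≤ LinearMap.ker φ := by
      rw [LinearMap.ker_rangeRestrict, ← hd]
      exact LinearMap.range_le_ker_iff.2 hφ
    obtain ⟨ψ, hψ⟩ := h ((LinearMap.ker (d (i + 1)).rangeRestrict).liftQ φ hker ∘ₗ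
      ((d (i + 1)).rangeRestrict.quotKerEquivOfSurjective
        (LinearMap.surjective_rangeRestrict _)).symm.toLinearMap)
    refine ⟨ψ, LinearMap.ext fun x ↦ ?_⟩
    have := LinearMap.congr_fun hψ ((d (i + 1)).rangeRestrict x)
    have hx : ((d (i + 1)).rangeRestrict.quotKerEquivOfSurjective
        (LinearMap.surjective_rangeRestrict _)).symm ((d (i + 1)).rangeRestrict x) =
        Submodule.Quotient.mk x := by
      rw [LinearEquiv.symm_apply_eq]
      rfl
    rw [LinearMap.comp_apply, LinearMap.comp_apply, LinearEquiv.coe_coe, hx] at this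
    exact this

/-- For an exact complex of flat modules, `A ⊗ F` is exact if and only if maps from the
cycles to the character module of `A` extend. -/
lemma rTensor_exact_iff_extension (i : ℤ) :
    (RTensor.mapRight R A (d i)).range = (RTensor.mapRight R A (d (i + 1))).ker ↔
    ∀ φ : LinearMap.range (d (i + 1)) →ₗ[R] LeftCharacter A,
      ∃ ψ : F (i + 1 + 1) →ₗ[R] LeftCharacter A,
        ψ ∘ₗ (LinearMap.range (d (i + 1))).subtype = φ := by
  rw [RTensor.range_mapRight_eq_ker_iff _ _ (comp_eq_zero_of_range_eq_ker hd i)]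
  exact hom_exact_iff_extension (ModuleCat.of R (LeftCharacter A)) hd i

end Complex

/-! ### Gorenstein flat dimension and `Ext` -/

lemma IsGorensteinFlat.subsingleton_ext (hA : Module.Injective Rᵐᵒᵖ A) {M : ModuleCat.{u} R}
    (hM : IsGorensteinFlat R M) (n : ℕ) :
    Subsingleton (Ext M (ModuleCat.of R (LeftCharacter A)) (n + 1)) := by
  obtain ⟨F, d, hF, hd, ⟨e⟩, hex⟩ := hM
  have key : ∀ (i : ℤ), Subsingleton (Ext (ModuleCat.of R (LinearMap.range (d i)))
      (ModuleCat.of R (LeftCharacter A)) (n + 1)) := by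
    induction n with
    | zero =>
      intro i
      obtain ⟨j, rfl⟩ : ∃ j, i = j + 1 + 1 := ⟨i - 1 - 1, by ring⟩
      exact (isShortExact_range hd (j + 1)).subsingleton_ext_one
        (IsFlatModule.subsingleton_ext A 0 _ (hF _))
        ((rTensor_exact_iff_extension A hd j).1 (hex A hA j))
    | succ n ih =>
      intro i
      obtain ⟨j, rfl⟩ : ∃ j, i = j + 1 := ⟨i - 1, by ring⟩
      exact (isShortExact_range hd j).subsingleton_ext_right (ih j)
        (IsFlatModule.subsingleton_ext A (n + 1) _ (hF _))
  exact subsingleton_ext_of_linearEquiv _ e _ (key 0)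

lemma gfdLE.subsingleton_ext (hA : Module.Injective Rᵐᵒᵖ A) {n m : ℕ} {M : ModuleCat.{u} R}
    (hM : gfdLE R n M) (hnm : n ≤ m) :
    Subsingleton (Ext M (ModuleCat.of R (LeftCharacter A)) (m + 1)) := by
  induction n generalizing M m with
  | zero => exact IsGorensteinFlat.subsingleton_ext A hA hM m
  | succ n ih =>
    obtain ⟨m, rfl⟩ : ∃ k, m = k + 1 := ⟨m - 1, by omega⟩
    obtain ⟨K, G, f, g, hG, hf, hg, hfg, hK⟩ := hM
    exact IsShortExact.subsingleton_ext_right ⟨hf, hg, hfg⟩ (ih hK (by omega))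
      (hG.subsingleton_ext A hA (m + 1))

end Ext

section Main

variable {R : Type u} [Ring R]

lemma isGorensteinProjective_range (k : ℕ) (P : ℤ → ModuleCat.{u} R)
    (d : ∀ i : ℤ, P i →ₗ[R] P (i + 1)) (hP : ∀ i, Module.Projective R (P i))
    (hd : ∀ i, LinearMap.range (d i) = LinearMap.ker (d (i + 1)))
    (hQ : ∀ (Q : ModuleCat.{u} R), Module.Projective R Q →
      ∀ (i : ℤ) (f : P (i + 1) →ₗ[R] Q), f ∘ₗ d i = 0 →
        ∃ g : P (i + 1 + 1) →ₗ[R] Q, g ∘ₗ d (i + 1) = f) :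
    IsGorensteinProjective R (ModuleCat.of R (LinearMap.range (d k))) := by
  induction k generalizing P with
  | zero => exact ⟨P, d, hP, hd, ⟨LinearEquiv.refl R _⟩, hQ⟩
  | succ k ih =>
    exact ih (fun i ↦ P (i + 1)) (fun i ↦ d (i + 1)) (fun i ↦ hP _) (fun i ↦ hd _)
      fun Q hQ' i ↦ hQ Q hQ' (i + 1)

/-- If all Gorenstein projective modules have Gorenstein flat dimension at most `n`, they are
all Gorenstein flat. -/
lemma IsGorensteinProjective.isGorensteinFlat {n : ℕ}
    (hn : ∀ M : ModuleCat.{u} R, IsGorensteinProjective R M → ∃ m ≤ n, gfdLE R m M)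
    {M : ModuleCat.{u} R} (hM : IsGorensteinProjective R M) : IsGorensteinFlat R M := by
  obtain ⟨P, d, hP, hd, e, hQ⟩ := hM
  refine ⟨P, d, fun i ↦ IsFlatModule.of_projective, hd, e, fun A _ _ hA i ↦ ?_⟩
  let V (j : ℤ) (m : ℕ) : Prop := Subsingleton (Abelian.Ext
    (ModuleCat.of R (LinearMap.range (d j))) (ModuleCat.of R (LeftCharacter A)) (m + 1))
  have hV_step (j : ℤ) (m : ℕ) (h : V (j + 1) (m + 1)) : V j m :=
    (isShortExact_range hd j).subsingleton_ext_left (subsingleton_ext_succ_of_projective _ m) h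
  have hV_large (k m : ℕ) (hm : n ≤ m) : V k m := by
    obtain ⟨l, hl, h⟩ := hn _ (isGorensteinProjective_range k P d hP hd hQ)
    exact h.subsingleton_ext A hA (hl.trans hm)
  have hV_shift (k : ℕ) : ∀ (j : ℤ) (m : ℕ), V (j + k) (m + k) → V j m := by
    induction k with
    | zero => simp
    | succ k ih =>
      intro j m h
      refine ih j m (hV_step _ _ ?_)
      rwa [Nat.cast_succ, ← add_assoc, ← add_assoc] at h
  have hV_zero (j : ℤ) : V j 0 := by
    refine hV_shift (n + j.natAbs) j 0 ?_
    obtain ⟨k, hk⟩ := Int.eq_ofNat_of_zero_le (a := j + (n + j.natAbs : ℕ)) (by omega)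
    rw [hk]
    exact hV_large k _ (by omega)
  exact (rTensor_exact_iff_extension A hd i).2
    ((isShortExact_range hd (i + 1)).exists_extension
      (Y := ModuleCat.of R (LeftCharacter A)) (hV_zero (i + 1 + 1)))

lemma exists_gfdLE_of_gfd_le {n : ℕ} {M : ModuleCat.{u} R} (h : gfd R M ≤ n) :
    ∃ m ≤ n, gfdLE R m M := by
  have hne : {n : ℕ∞ | ∃ m : ℕ, n = (m : ℕ∞) ∧ gfdLE R m M}.Nonempty := by
    by_contra! hempty
    rw [gfd, hempty, sInf_empty] at h
    exact ENat.natCast_ne_top n (top_le_iff.1 h)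
  obtain ⟨m, hm, hM⟩ := csInf_mem hne
  refine ⟨m, ?_, hM⟩
  rw [gfd, hm] at h
  exact_mod_cast h

end Main

/-- For any ring `R`, `sup {Gfd_R(M) : M Gorenstein projective}` is either `0` or `∞`. -/
theorem iSup_gfd_gorensteinProjective_eq_zero_or_top (R : Type u) [Ring R] :
    (⨆ (M : ModuleCat.{u} R) (_ : IsGorensteinProjective R M), gfd R M) = 0 ∨
    (⨆ (M : ModuleCat.{u} R) (_ : IsGorensteinProjective R M), gfd R M) = ⊤ := by
  by_cases htop : (⨆ (M : ModuleCat.{u} R) (_ : IsGorensteinProjective R M), gfd R M) = ⊤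
  · exact Or.inr htop
  left
  obtain ⟨n, hn⟩ := ENat.ne_top_iff_exists.1 htop
  have hle (M : ModuleCat.{u} R) (hM : IsGorensteinProjective R M) : ∃ m ≤ n, gfdLE R m M :=
    exists_gfdLE_of_gfd_le (hn ▸ le_iSup₂ (f := fun M _ ↦ gfd R M) M hM)
  refine le_antisymm (iSup₂_le fun M hM ↦ sInf_le ?_) bot_le
  exact ⟨0, rfl, hM.isGorensteinFlat hle⟩
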